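/- Assume (F0), (F1) and (F2). There exist ergodic G-invariant Borel probability measures μ₁ and μ₂ with μ₁(Λ_G)=μ₂(Λ_G)=1 such that π⁎μ₁ = π⁎μ₂ = the (1/2,0,1/2)-Bernoulli measure on Σ₃, χ(μ₁) ≤ 0, μ₂(Λ₀₂)=1, and χ(μ₂) = (1/2)·log(β₀·β₂) > 0. -/

import Mathlib

open Set Filter MeasureTheory

noncomputable section

/-- Condition (F0) on the fiber map `f₀`. -/
def F0cond (f₀ : ℝ → ℝ) (β₀ lam₀ : ℝ) : Prop :=
  ContDiff ℝ 1 f₀ ∧ Set.MapsTo f₀ (Set.Icc 0 1) (Set.Icc 0 1) ∧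
  StrictMonoOn f₀ (Set.Icc 0 1) ∧ f₀ 0 = 0 ∧ f₀ 1 = 1 ∧
  (∀ x ∈ Set.Ioo (0:ℝ) 1, x < f₀ x) ∧
  deriv f₀ 0 = β₀ ∧ 1 < β₀ ∧ deriv f₀ 1 = lam₀ ∧ 0 < lam₀ ∧ lam₀ < 1 ∧
  (∀ x ∈ Set.Icc (0:ℝ) 1, lam₀ ≤ deriv f₀ x)

/-- Condition (F1) on the fiber map `f₁`. -/
def F1cond (f₁ : ℝ → ℝ) (γ lam₀ : ℝ) : Prop :=
  (∀ x, f₁ x = γ * (1 - x)) ∧ lam₀ ≤ γ ∧ γ < 1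

/-- Condition (F2) on the fiber map `f₂`. -/
def F2cond (f₂ : ℝ → ℝ) (β₂ lam₀ : ℝ) : Prop :=
  ContDiff ℝ 1 f₂ ∧ Set.MapsTo f₂ (Set.Icc 0 1) (Set.Icc 0 1) ∧
  StrictMonoOn f₂ (Set.Icc 0 1) ∧ f₂ 0 = 0 ∧
  deriv f₂ 0 = β₂ ∧ 1 < β₂ ∧ (∀ x ∈ Set.Icc (0:ℝ) 1, lam₀ ≤ deriv f₂ x) ∧
  ∃ p₂, p₂ ∈ Set.Ioo (0:ℝ) 1 ∧ f₂ p₂ = p₂ ∧ (∀ x ∈ Set.Ioo 0 p₂, x < f₂ x) ∧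
    (∀ x ∈ Set.Ioc p₂ 1, f₂ x < x)

/-- Condition (F01). -/
def F01cond (f₀ : ℝ → ℝ) (β₀ lam₀ γ : ℝ) : Prop :=
  AntitoneOn (deriv f₀) (Set.Icc 0 1) ∧
  1 < γ * (lam₀ ^ 3 * (1 - lam₀) / (1 - β₀⁻¹))

/-- Condition (F012), with `H = [0,δ]`, `H' = [1-γ⁻¹δ,1]`, and the derived constants
`β' = βpr`, `β_H = βH`, `λ' = lampr`, `L`. -/
def F012cond (f₀ f₁ f₂ : ℝ → ℝ) (γ lam₀ β₀ β₂ δ βpr βH lampr : ℝ) (L : ℕ) : Prop :=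
  (∀ x ∈ Set.Icc (0:ℝ) 1, deriv f₀ x ≤ max β₀ β₂ ∧ deriv f₂ x ≤ max β₀ β₂) ∧
  0 < δ ∧ δ < γ ∧
  (f₁ '' Set.Icc 0 δ) ∩ Set.Icc 0 δ = ∅ ∧
  (f₁ '' Set.Icc (1 - γ⁻¹ * δ) 1) ∩ Set.Icc (1 - γ⁻¹ * δ) 1 = ∅ ∧
  (f₁ '' Set.Icc 0 1) ∩ Set.Icc (1 - γ⁻¹ * δ) 1 = ∅ ∧
  (f₂ '' Set.Icc 0 1) ∩ Set.Icc (1 - γ⁻¹ * δ) 1 = ∅ ∧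
  IsGreatest {y | ∃ x ∈ Set.Icc δ 1, y = max (deriv f₀ x) (deriv f₂ x)} βpr ∧
  1 < βpr ∧ βpr < min β₀ β₂ ∧
  IsLeast {y | ∃ x ∈ Set.Icc (0:ℝ) δ, y = min (deriv f₀ x) (deriv f₂ x)} βH ∧
  1 < βH ∧ βH < min β₀ β₂ ∧
  IsGreatest {y | ∃ x ∈ Set.Icc (1 - γ⁻¹ * δ) 1, y = deriv f₀ x} lampr ∧
  lampr < 1 ∧
  |Real.log lam₀| * Real.log (max β₀ β₂) / Real.log βH - |Real.log lampr|
      + (2 / 3) * Real.log (max β₀ β₂) < (3 / 4) * Real.log βpr ∧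
  1 ≤ L ∧
  4 * |Real.log lam₀| * Real.log (max β₀ β₂) / (Real.log βH * Real.log βpr) < (L : ℝ) ∧
  Real.log ((max β₀ β₂) ^ L * γ) / ((L : ℝ) + 1) < Real.log βpr

/-- `f_{ξ_{n-1}} ∘ ⋯ ∘ f_{ξ₀}`. -/
def seqComp (fs : Fin 3 → ℝ → ℝ) (ξ : ℕ → Fin 3) : ℕ → ℝ → ℝ
  | 0 => id
  | n + 1 => fun x => fs (ξ n) (seqComp fs ξ n x)

/-- The upper Lyapunov exponent of the point `p` under the itinerary `ξ`. -/
def lyapUpper (fs : Fin 3 → ℝ → ℝ) (p : ℝ) (ξ : ℕ → Fin 3) : ℝ :=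
  Filter.limsup (fun n : ℕ => (1 / (n : ℝ)) * Real.log |deriv (seqComp fs ξ n) p|) Filter.atTop

/-- Membership in the exceptional set `E`. -/
def exceptional (fs : Fin 3 → ℝ → ℝ) (p : ℝ) (ξ : ℕ → Fin 3) : Prop :=
  ∃ m : ℕ, seqComp fs ξ m p = 0 ∧ ∀ j, m ≤ j → (ξ j = 0 ∨ ξ j = 2)

/-- `f_[w] = f_{w_{m-1}} ∘ ⋯ ∘ f_{w₀}` for a finite word `w`. -/
def wordComp {α : Type*} (fs : α → ℝ → ℝ) (w : List α) : ℝ → ℝ :=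
  fun x => w.foldl (fun y i => fs i y) x

/-- The two-sided sequence space `Σ₃`. -/
abbrev Sig3 := ℤ → Fin 3

/-- The state space `Σ₃ × [0,1]`. -/
abbrev XSp := Sig3 × (Set.Icc (0:ℝ) 1)

instance : UniformSpace (Fin 3) := ⊥

/-- The left shift on `Σ₃`. -/
def shiftMap (ξ : Sig3) : Sig3 := fun i => ξ (i + 1)

/-- The step skew product `G(ξ,x) = (σξ, f_{ξ₀}(x))` on `Σ₃ × [0,1]`. -/
def Gmap (fs : Fin 3 → ℝ → ℝ) : XSp → XSp :=
  fun p => (shiftMap p.1, Set.projIcc 0 1 (by norm_num) (fs (p.1 0) (p.2 : ℝ)))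

/-- The maximal invariant set `Λ_G = ⋂ₙ Gⁿ(Σ₃ × [0,1])`. -/
def LamG (fs : Fin 3 → ℝ → ℝ) : Set XSp := ⋂ n : ℕ, (Gmap fs)^[n] '' Set.univ

/-- The lateral horseshoe `Λ₀₂`. -/
def Lam02 : Set XSp := {p | (∀ i, p.1 i ≠ 1) ∧ (p.2 : ℝ) = 0}

/-- The central derivative potential `φ(ξ,x) = log|f_{ξ₀}'(x)|`. -/
def phiC (fs : Fin 3 → ℝ → ℝ) (p : XSp) : ℝ := Real.log |deriv (fs (p.1 0)) (p.2 : ℝ)|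

/-- The central Lyapunov exponent `χ(μ) = ∫ φ dμ` of a measure. -/
def chiOf (fs : Fin 3 → ℝ → ℝ) (μ : Measure XSp) : ℝ := ∫ p, phiC fs p ∂μ

/-- `ν` is the `(p 0, p 1, p 2)`-Bernoulli measure on `Σ₃`. -/
def IsBernoulli (p : Fin 3 → ℝ) (ν : Measure Sig3) : Prop :=
  IsProbabilityMeasure ν ∧ ∀ (s : Finset ℤ) (a : ℤ → Fin 3),
    ν {ξ | ∀ i ∈ s, ξ i = a i} = ENNReal.ofReal (∏ i ∈ s, p (a i))


lemma shiftMap_iter (n : ℕ) (ξ : Sig3) (i : ℤ) : (shiftMap^[n] ξ) i = ξ (i + n) := by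
  induction n generalizing ξ i with
  | zero => simp
  | succ k ih =>
    rw [Function.iterate_succ_apply, ih]
    simp only [shiftMap]
    congr 1
    push_cast
    ring

lemma measurable_shiftMap : Measurable shiftMap := by
  unfold shiftMap
  fun_prop

/-- the one-symbol distribution -/
def nuOne : Measure (Fin 3) :=
  ENNReal.ofReal (1/2) • Measure.dirac 0 + ENNReal.ofReal (1/2) • Measure.dirac 2

instance : IsProbabilityMeasure nuOne := by
  constructor
  simp only [nuOne, Measure.add_apply, Measure.smul_apply, measure_univ, smul_eq_mul, mul_one]
  rw [← ENNReal.ofReal_add (by norm_num) (by norm_num)]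
  norm_num

/-- the Bernoulli measure -/
def nuB : Measure Sig3 := Measure.infinitePi (fun _ : ℤ => nuOne)

instance : IsProbabilityMeasure nuB := by
  unfold nuB
  infer_instance

lemma nuOne_singleton (a : Fin 3) :
    nuOne {a} = ENNReal.ofReal ((![(1:ℝ)/2, 0, 1/2] : Fin 3 → ℝ) a) := by
  fin_cases a <;> simp [nuOne]

lemma nuB_bernoulli : IsBernoulli ![(1:ℝ)/2, 0, 1/2] nuB := by
  refine ⟨inferInstance, fun s a => ?_⟩
  have : {ξ : Sig3 | ∀ i ∈ s, ξ i = a i} = Set.pi (s : Set ℤ) (fun i => {a i}) := by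
    ext ξ
    simp [Set.mem_pi]
  rw [this, nuB, Measure.infinitePi_pi _ (by intros; measurability)]
  rw [ENNReal.ofReal_prod_of_nonneg]
  · exact Finset.prod_congr rfl fun i _ => nuOne_singleton _
  · intro i _
    generalize a i = b
    fin_cases b <;> simp

lemma nuB_mp : MeasurePreserving shiftMap nuB nuB := by
  refine ⟨measurable_shiftMap, ?_⟩
  have := Measure.map_infinitePi_infinitePi_of_inj (P := fun _ : ℤ => nuOne)
    (f := fun i : ℤ => i + 1) (add_left_injective 1)
  exact this

lemma nuB_mixing (C : Set Sig3) (hC : C ∈ measurableCylinders (fun _ : ℤ => Fin 3)) :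
    ∃ n : ℕ, nuB (C ∩ shiftMap^[n] ⁻¹' C) = nuB C * nuB C := by
  obtain ⟨s, S, hS, rfl⟩ := (mem_measurableCylinders _).1 hC
  obtain ⟨N, hN⟩ : ∃ N : ℕ, ∀ i ∈ s, |i| < N := by
    refine ⟨(∑ i ∈ s, i.natAbs) + 1, fun i hi => ?_⟩
    have := Finset.single_le_sum (f := fun i : ℤ => i.natAbs) (fun _ _ => Nat.zero_le _) hi
    rw [Int.abs_eq_natAbs]
    omega
  let e : ℤ ↪ ℤ := ⟨fun i => i + (2 * N : ℕ), add_left_injective _⟩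
  have hdis : Disjoint s (s.map e) := by
    rw [Finset.disjoint_left]
    intro i hi hi'
    obtain ⟨j, hj, rfl⟩ := Finset.mem_map.1 hi'
    have h1 := hN _ hi
    have h2 := hN _ hj
    simp only [e, Function.Embedding.coeFn_mk] at h1
    rw [abs_lt] at h1 h2
    push_cast at h1
    omega
  have hind := ProbabilityTheory.iIndepFun.indepFun_finset s (s.map e) hdis
    (ProbabilityTheory.iIndepFun_infinitePi (P := fun _ : ℤ => nuOne)
      (X := fun _ ω => ω) (fun _ => measurable_id)) (fun i => by fun_prop)
  let r : (∀ i : (s.map e), Fin 3) → (∀ i : s, Fin 3) :=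
    fun x i => x ⟨e i, Finset.mem_map_of_mem e i.2⟩
  have hr : Measurable r := by
    unfold r
    fun_prop
  refine ⟨2 * N, ?_⟩
  have := hind.measure_inter_preimage_eq_mul S (r ⁻¹' S) hS (hr hS)
  have e1 : (fun (a : Sig3) (i : (s.map e)) ↦ a i) ⁻¹' (r ⁻¹' S)
      = shiftMap^[2 * N] ⁻¹' (cylinder s S) := by
    ext ξ
    simp only [mem_preimage, mem_cylinder]
    have : r (fun (i : (s.map e)) ↦ ξ i) = s.restrict (shiftMap^[2 * N] ξ) := by
      funext i
      simp [r, e, shiftMap_iter]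
    rw [this]
  have e2 : (fun (a : Sig3) (i : s) ↦ a i) ⁻¹' S = cylinder s S := rfl
  have e3 : nuB (shiftMap^[2 * N] ⁻¹' (cylinder s S)) = nuB (cylinder s S) :=
    (nuB_mp.iterate (2 * N)).measure_preimage hS.cylinder.nullMeasurableSet
  change nuB _ = nuB _ * nuB _ at this
  rw [e1, e2, e3] at this
  exact this

lemma nuB_ergodic : Ergodic shiftMap nuB := by
  refine ⟨nuB_mp, ⟨fun {A} hA hinv => ?_⟩⟩
  have hd := Measure.MeasureDense.of_generateFrom_isSetAlgebra_finite (μ := nuB)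
    (isSetAlgebra_measurableCylinders (α := fun _ : ℤ => Fin 3))
    generateFrom_measurableCylinders.symm
  have key : nuB.real A = nuB.real A * nuB.real A := by
    by_contra hne
    have hpos : 0 < |nuB.real A - nuB.real A * nuB.real A| := abs_pos.2 (sub_ne_zero.2 hne)
    set ε := |nuB.real A - nuB.real A * nuB.real A| / 5 with hε
    obtain ⟨C, hC, hAC⟩ := hd.approx A hA (measure_ne_top _ _) ε (by positivity)
    have hCm : MeasurableSet C := .of_mem_measurableCylinders hC
    obtain ⟨n, hn⟩ := nuB_mixing C hC
    have hAn : shiftMap^[n] ⁻¹' A = A := by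
      clear hn
      induction n with
      | zero => rfl
      | succ k ih => rw [Function.iterate_succ, preimage_comp, ih, hinv]
    have hs : nuB.real (symmDiff A C) < ε := by
      rw [measureReal_def]
      exact (ENNReal.toReal_lt_of_lt_ofReal hAC)
    have h1 : |nuB.real A - nuB.real C| ≤ nuB.real (symmDiff A C) :=
      abs_measureReal_sub_le_measureReal_symmDiff hA.nullMeasurableSet hCm.nullMeasurableSet
    have hCn : MeasurableSet (shiftMap^[n] ⁻¹' C) := (measurable_shiftMap.iterate n) hCm
    have h2 : |nuB.real A - nuB.real (C ∩ shiftMap^[n] ⁻¹' C)| ≤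
        nuB.real (symmDiff A (C ∩ shiftMap^[n] ⁻¹' C)) :=
      abs_measureReal_sub_le_measureReal_symmDiff hA.nullMeasurableSet
        (hCm.inter hCn).nullMeasurableSet
    have h3 : nuB.real (symmDiff A (C ∩ shiftMap^[n] ⁻¹' C)) ≤
        nuB.real (symmDiff A C) + nuB.real (symmDiff A C) := by
      have h4 : nuB.real (shiftMap^[n] ⁻¹' (symmDiff A C)) = nuB.real (symmDiff A C) := by
        rw [measureReal_def, measureReal_def,
          (nuB_mp.iterate n).measure_preimage (hA.symmDiff hCm).nullMeasurableSet]
      have h5 : symmDiff A (C ∩ shiftMap^[n] ⁻¹' C) ⊆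
          symmDiff A C ∪ shiftMap^[n] ⁻¹' (symmDiff A C) := by
        have : shiftMap^[n] ⁻¹' (symmDiff A C) = symmDiff A (shiftMap^[n] ⁻¹' C) := by
          conv_rhs => rw [← hAn]
          rfl
        rw [this]
        intro x
        simp only [Set.mem_symmDiff, mem_union, mem_inter_iff]
        tauto
      calc _ ≤ nuB.real (symmDiff A C ∪ shiftMap^[n] ⁻¹' (symmDiff A C)) :=
            measureReal_mono h5
        _ ≤ _ := measureReal_union_le _ _
        _ = _ := by rw [h4]
    have h6 : nuB.real (C ∩ shiftMap^[n] ⁻¹' C) = nuB.real C * nuB.real C := by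
      rw [measureReal_def, hn, ENNReal.toReal_mul, measureReal_def]
    rw [h6] at h2
    have a0 : 0 ≤ nuB.real A := measureReal_nonneg
    have a1 : nuB.real A ≤ 1 := measureReal_le_one
    have c0 : 0 ≤ nuB.real C := measureReal_nonneg
    have c1 : nuB.real C ≤ 1 := measureReal_le_one
    have h7 : |nuB.real C * nuB.real C - nuB.real A * nuB.real A| ≤
        2 * |nuB.real A - nuB.real C| := by
      have : nuB.real C * nuB.real C - nuB.real A * nuB.real A =
        -((nuB.real A + nuB.real C) * (nuB.real A - nuB.real C)) := by ring
      rw [this, abs_neg, abs_mul, abs_of_nonneg (by positivity)]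
      gcongr
      linarith
    have h8 := abs_sub_le (nuB.real A) (nuB.real C * nuB.real C) (nuB.real A * nuB.real A)
    have : |nuB.real A - nuB.real A * nuB.real A| = 5 * ε := by rw [hε]; ring
    linarith
  rw [eventuallyConst_set']
  have : nuB.real A = 0 ∨ nuB.real A = 1 := by
    have : nuB.real A * (nuB.real A - 1) = 0 := by linarith
    rcases mul_eq_zero.1 this with h | h
    · exact Or.inl h
    · exact Or.inr (by linarith)
  rcases this with h | h
  · left
    rw [ae_eq_empty]
    exact (measureReal_eq_zero_iff).1 h
  · right
    rw [ae_eq_univ, prob_compl_eq_zero_iff hA]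
    rw [measureReal_def] at h
    exact (ENNReal.toReal_eq_one_iff _).1 h

lemma nuB_ae_ne_one : ∀ᵐ ξ ∂nuB, ∀ i, ξ i ≠ 1 := by
  rw [ae_all_iff]
  intro i
  have h := nuB_bernoulli.2 {i} (fun _ => 1)
  simp only [Finset.mem_singleton, forall_eq, Finset.prod_singleton] at h
  rw [ae_iff]
  simpa using h

lemma lift_props (fs : Fin 3 → ℝ → ℝ) (hfm : ∀ i, Measurable (fs i))
    (φ : Sig3 → Set.Icc (0:ℝ) 1) (hφ : Measurable φ)
    (hinv : ∀ ξ : Sig3, (∀ i, ξ i ≠ 1) → Gmap fs (ξ, φ ξ) = (shiftMap ξ, φ (shiftMap ξ))) :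
    IsProbabilityMeasure (nuB.map (fun ξ => (ξ, φ ξ))) ∧
    Ergodic (Gmap fs) (nuB.map (fun ξ => (ξ, φ ξ))) ∧
    (nuB.map (fun ξ => (ξ, φ ξ))) (LamG fs) = 1 ∧
    IsBernoulli ![(1:ℝ)/2, 0, 1/2] ((nuB.map (fun ξ => (ξ, φ ξ))).map Prod.fst) := by
  have hΦ : Measurable (fun ξ : Sig3 => (ξ, φ ξ)) := by fun_prop
  have hp : IsProbabilityMeasure (nuB.map (fun ξ => (ξ, φ ξ))) :=
    Measure.isProbabilityMeasure_map hΦ.aemeasurable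
  have hG : Measurable (Gmap fs) := by
    unfold Gmap
    refine Measurable.prodMk (measurable_shiftMap.comp measurable_fst) ?_
    refine continuous_projIcc.measurable.comp ?_
    have h1 : Measurable (fun q : Fin 3 × ℝ => fs q.1 q.2) :=
      measurable_from_prod_countable_right (fun i => hfm i)
    have h2 : Measurable (fun p : XSp => (p.1 0, (p.2 : ℝ))) :=
      (Measurable.comp (measurable_pi_apply (0:ℤ)) measurable_fst).prodMk
        (measurable_subtype_coe.comp measurable_snd)
    exact h1.comp h2
  have hmp : MeasurePreserving (Gmap fs) (nuB.map (fun ξ => (ξ, φ ξ)))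
      (nuB.map (fun ξ => (ξ, φ ξ))) := by
    refine ⟨hG, ?_⟩
    rw [Measure.map_map hG hΦ]
    calc _ = nuB.map ((fun ξ => (ξ, φ ξ)) ∘ shiftMap) := by
          apply Measure.map_congr
          filter_upwards [nuB_ae_ne_one] with ξ hξ
          exact hinv ξ hξ
      _ = (nuB.map shiftMap).map (fun ξ => (ξ, φ ξ)) :=
          (Measure.map_map hΦ measurable_shiftMap).symm
      _ = _ := by rw [nuB_mp.map_eq]
  refine ⟨hp, ⟨hmp, ⟨fun {s} hs hs' => ?_⟩⟩, ?_, ?_⟩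
  · have h1 : shiftMap ⁻¹' ((fun ξ => (ξ, φ ξ)) ⁻¹' s) =ᵐ[nuB] ((fun ξ => (ξ, φ ξ)) ⁻¹' s) := by
      filter_upwards [nuB_ae_ne_one] with ξ hξ
      apply propext
      change (shiftMap ξ, φ (shiftMap ξ)) ∈ s ↔ (ξ, φ ξ) ∈ s
      rw [← hinv ξ hξ]
      conv_rhs => rw [← hs']
      rfl
    have h2 := nuB_ergodic.quasiErgodic.ae_empty_or_univ₀ (hΦ hs).nullMeasurableSet h1
    rw [eventuallyConst_set']
    rcases h2 with h | h
    · left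
      rw [ae_eq_empty] at h ⊢
      rwa [Measure.map_apply hΦ hs]
    · right
      rw [ae_eq_univ] at h ⊢
      rwa [Measure.map_apply hΦ hs.compl, preimage_compl]
  · apply le_antisymm prob_le_one
    refine le_trans ?_ (Measure.le_map_apply hΦ.aemeasurable _)
    have : ∀ᵐ ξ ∂nuB, ξ ∈ (fun ξ => (ξ, φ ξ)) ⁻¹' (LamG fs) := by
      filter_upwards [nuB_ae_ne_one] with ξ hξ
      simp only [mem_preimage, LamG, mem_iInter, image_univ, mem_range]
      intro n
      have key : ∀ (n : ℕ) (η : Sig3), (∀ i, η i ≠ 1) →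
          (Gmap fs)^[n] (η, φ η) = (shiftMap^[n] η, φ (shiftMap^[n] η)) := by
        intro n
        induction n with
        | zero => intro η _; rfl
        | succ k ih =>
          intro η hη
          rw [Function.iterate_succ_apply, hinv η hη, ih (shiftMap η) (fun i => hη (i+1))]
          rfl
      refine ⟨((fun i => ξ (i - n)), φ (fun i => ξ (i - n))), ?_⟩
      rw [key n _ (fun i => hξ _)]
      have : shiftMap^[n] (fun i => ξ (i - n)) = ξ := by
        funext i
        rw [shiftMap_iter]
        simp
      rw [this]
    exact ((measure_congr (eventuallyEq_univ.2 this)).trans measure_univ).ge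
  · rw [Measure.map_map measurable_fst hΦ]
    have : (Prod.fst ∘ fun ξ : Sig3 => (ξ, φ ξ)) = id := rfl
    rw [this, Measure.map_id]
    exact nuB_bernoulli

lemma integral_eval_zero (c : Fin 3 → ℝ) :
    ∫ ξ : Sig3, c (ξ 0) ∂nuB = (1/2) * c 0 + (1/2) * c 2 := by
  have h : nuB.map (fun ξ : Sig3 => ξ 0) = nuOne := Measure.infinitePi_map_eval _ 0
  rw [← integral_map (φ := fun ξ : Sig3 => ξ 0) (f := c)
    (measurable_pi_apply (0:ℤ)).aemeasurable
    (Measurable.aestronglyMeasurable (by fun_prop)), h, nuOne,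
    integral_add_measure, integral_smul_measure, integral_smul_measure]
  · simp
  all_goals
    apply Integrable.smul_measure _ ENNReal.ofReal_ne_top
    exact Integrable.of_finite

lemma integral_nonpos_of_cob (q u : Sig3 → ℝ) (hq : Measurable q) (hu : Measurable u) (C : ℝ)
    (hC : ∀ᵐ ξ ∂nuB, |q ξ| ≤ C) (hu0 : ∀ᵐ ξ ∂nuB, u ξ ≤ 0)
    (h : ∀ᵐ ξ ∂nuB, q ξ ≤ u (shiftMap ξ) - u ξ) : ∫ ξ, q ξ ∂nuB ≤ 0 := by
  have hit : ∀ {p : Sig3 → Prop}, (∀ᵐ ξ ∂nuB, p ξ) → ∀ᵐ ξ ∂nuB, ∀ n, p (shiftMap^[n] ξ) := by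
    intro p hp
    rw [ae_all_iff]
    intro n
    exact (nuB_mp.iterate n).quasiMeasurePreserving.ae hp
  have hint : Integrable q nuB :=
    Integrable.of_bound hq.aestronglyMeasurable C (by simpa [Real.norm_eq_abs] using hC)
  have hcomp : ∀ n, ∫ ξ, q (shiftMap^[n] ξ) ∂nuB = ∫ ξ, q ξ ∂nuB := by
    intro n
    have := (nuB_mp.iterate n)
    rw [← integral_map (φ := shiftMap^[n]) (f := q) this.measurable.aemeasurable
      hq.aestronglyMeasurable, this.map_eq]
  have hintn : ∀ n, Integrable (fun ξ => q (shiftMap^[n] ξ)) nuB := fun n =>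
    (nuB_mp.iterate n).integrable_comp_of_integrable hint
  have hsum : ∀ N : ℕ, ∀ᵐ ξ ∂nuB, ∑ n ∈ Finset.range (N+1), q (shiftMap^[n] ξ)
      ≤ min ((N+1 : ℝ) * C) (- u ξ) := by
    intro N
    filter_upwards [hit hC, hit hu0, hit h] with ξ h1 h2 h3
    apply le_min
    · calc _ ≤ ∑ n ∈ Finset.range (N+1), C :=
            Finset.sum_le_sum fun i _ => (le_abs_self _).trans (h1 i)
        _ = _ := by simp
    · have : ∀ M : ℕ, ∑ n ∈ Finset.range M, q (shiftMap^[n] ξ) ≤ u (shiftMap^[M] ξ) - u ξ := by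
        intro M
        induction M with
        | zero => simp
        | succ k ih =>
          rw [Finset.sum_range_succ]
          have := h3 k
          rw [← Function.iterate_succ_apply' shiftMap] at this
          linarith
      linarith [this (N+1), h2 (N+1)]
  have hC0 : 0 ≤ C := by
    obtain ⟨ξ, hξ⟩ := hC.exists
    exact (abs_nonneg _).trans hξ
  have hle : ∀ N : ℕ, ∫ ξ, q ξ ∂nuB ≤ ∫ ξ, min C (- u ξ / (N+1 : ℝ)) ∂nuB := by
    intro N
    have hN : (0:ℝ) < N + 1 := by positivity
    have h1 : ∫ ξ, q ξ ∂nuB =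
        ∫ ξ, (∑ n ∈ Finset.range (N+1), q (shiftMap^[n] ξ)) / (N+1 : ℝ) ∂nuB := by
      rw [integral_div, integral_finsetSum _ (fun i _ => hintn i)]
      simp only [hcomp]
      simp
      field_simp
    rw [h1]
    apply integral_mono_ae
    · exact (integrable_finsetSum _ (fun i _ => hintn i)).div_const _
    · refine Integrable.of_bound (Measurable.aestronglyMeasurable (by fun_prop)) C ?_
      filter_upwards [hu0] with ξ h0
      rw [Real.norm_eq_abs, abs_of_nonneg]
      · exact min_le_left _ _
      · exact le_min hC0 (div_nonneg (by linarith) hN.le)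
    · filter_upwards [hsum N] with ξ hξ
      rw [le_min_iff] at hξ ⊢
      constructor
      · rw [div_le_iff₀ hN]; linarith
      · exact div_le_div_of_nonneg_right hξ.2 hN.le
  have hlim : Tendsto (fun N : ℕ => ∫ ξ, min C (- u ξ / (N+1 : ℝ)) ∂nuB) atTop
      (nhds (∫ ξ : Sig3, (0:ℝ) ∂nuB)) := by
    refine tendsto_integral_of_dominated_convergence (fun _ => C)
      (fun n => Measurable.aestronglyMeasurable (by fun_prop)) (integrable_const _) ?_ ?_
    · intro N
      have hN : (0:ℝ) < N + 1 := by positivity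
      filter_upwards [hu0] with ξ h0
      rw [Real.norm_eq_abs, abs_of_nonneg]
      · exact min_le_left _ _
      · exact le_min hC0 (div_nonneg (by linarith) hN.le)
    · refine ae_of_all _ fun ξ => ?_
      have : Tendsto (fun N : ℕ => - u ξ / (N+1 : ℝ)) atTop (nhds 0) := by
        have := (tendsto_one_div_add_atTop_nhds_zero_nat (𝕜 := ℝ)).const_mul (- u ξ)
        simpa [div_eq_mul_inv] using this
      have := (tendsto_const_nhds (x := C)).min this
      rwa [min_eq_right hC0] at this
  rw [integral_zero] at hlim
  exact ge_of_tendsto' hlim hle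

/-- pull-back iterates of the top -/
def gtop (h : Fin 3 → ℝ → ℝ) : ℕ → Sig3 → ℝ
  | 0, _ => 1
  | n + 1, ξ => h (ξ (-1)) (gtop h n (fun i => ξ (i - 1)))

lemma gtop_shift (h : Fin 3 → ℝ → ℝ) (n : ℕ) (ξ : Sig3) :
    gtop h (n + 1) (shiftMap ξ) = h (ξ 0) (gtop h n ξ) := by
  simp [gtop, shiftMap]

lemma slope_bounds (f : ℝ → ℝ) (hf : ContDiff ℝ 1 f) (lam M : ℝ)
    (hl : ∀ x ∈ Icc (0:ℝ) 1, lam ≤ deriv f x) (hM : ∀ x ∈ Icc (0:ℝ) 1, deriv f x ≤ M)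
    (x y : ℝ) (hx : 0 ≤ x) (hxy : x < y) (hy : y ≤ 1) :
    lam ≤ (f y - f x) / (y - x) ∧ (f y - f x) / (y - x) ≤ M := by
  obtain ⟨c, hc, hc'⟩ := exists_deriv_eq_slope f hxy hf.continuous.continuousOn
    (hf.differentiable (by norm_num)).differentiableOn
  rw [← hc']
  have : c ∈ Icc (0:ℝ) 1 := ⟨hx.trans hc.1.le, hc.2.le.trans hy⟩
  exact ⟨hl c this, hM c this⟩

lemma top_graph (h : Fin 3 → ℝ → ℝ) (lam : ℝ) (hlam : 0 < lam)
    (hC1 : ∀ i, ContDiff ℝ 1 (h i)) (hmaps : ∀ i, MapsTo (h i) (Icc 0 1) (Icc 0 1))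
    (hmono : ∀ i, StrictMonoOn (h i) (Icc 0 1))
    (hder : ∀ i, ∀ x ∈ Icc (0:ℝ) 1, lam ≤ deriv (h i) x) (h21 : h 2 1 < 1) :
    ∃ φ : Sig3 → Icc (0:ℝ) 1, Measurable φ ∧
      (∀ ξ, (φ (shiftMap ξ) : ℝ) = h (ξ 0) (φ ξ)) ∧
      ∫ ξ, Real.log |deriv (h (ξ 0)) (φ ξ : ℝ)| ∂nuB ≤ 0 := by
  have hg01 : ∀ n ξ, gtop h n ξ ∈ Icc (0:ℝ) 1 := by
    intro n
    induction n with
    | zero => intro ξ; simp [gtop]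
    | succ k ih => intro ξ; exact hmaps _ (ih _)
  have hanti : ∀ n ξ, gtop h (n+1) ξ ≤ gtop h n ξ := by
    intro n
    induction n with
    | zero => intro ξ; exact (hg01 1 ξ).2
    | succ k ih => intro ξ; exact (hmono _).monotoneOn (hg01 _ _) (hg01 _ _) (ih _)
  have hgm : ∀ n, Measurable (gtop h n) := by
    intro n
    induction n with
    | zero => exact measurable_const
    | succ k ih =>
      have h1 : Measurable (fun q : Fin 3 × ℝ => h q.1 q.2) :=
        measurable_from_prod_countable_right (fun i => (hC1 i).continuous.measurable)
      have h2 : Measurable (fun ξ : Sig3 => (ξ (-1), gtop h k (fun i => ξ (i - 1)))) :=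
        (measurable_pi_apply (-1:ℤ)).prodMk (ih.comp (by fun_prop))
      exact h1.comp h2
  have hbdd : ∀ ξ, BddBelow (range fun n => gtop h n ξ) := fun ξ =>
    ⟨0, by rintro _ ⟨n, rfl⟩; exact (hg01 n ξ).1⟩
  let φ : Sig3 → ℝ := fun ξ => ⨅ n, gtop h n ξ
  have hlim : ∀ ξ, Tendsto (fun n => gtop h n ξ) atTop (nhds (φ ξ)) := fun ξ =>
    tendsto_atTop_ciInf (antitone_nat_of_succ_le fun n => hanti n ξ) (hbdd ξ)
  have hφle : ∀ n ξ, φ ξ ≤ gtop h n ξ := fun n ξ => ciInf_le (hbdd ξ) n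
  have hφ01 : ∀ ξ, φ ξ ∈ Icc (0:ℝ) 1 := fun ξ =>
    ⟨le_ciInf fun n => (hg01 n ξ).1, (hφle 0 ξ).trans (hg01 0 ξ).2⟩
  have hφm : Measurable φ := measurable_of_tendsto_metrizable hgm (tendsto_pi_nhds.2 hlim)
  have hinv : ∀ ξ, φ (shiftMap ξ) = h (ξ 0) (φ ξ) := by
    intro ξ
    refine tendsto_nhds_unique ((tendsto_add_atTop_iff_nat 1).2 (hlim (shiftMap ξ))) ?_
    simp only [gtop_shift]
    exact ((hC1 (ξ 0)).continuous.tendsto _).comp (hlim ξ)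
  refine ⟨fun ξ => ⟨φ ξ, hφ01 ξ⟩, hφm.subtype_mk, hinv, ?_⟩
  simp only
  have one_mem : (1:ℝ) ∈ Icc (0:ℝ) 1 := by simp
  have hlt1 : ∀ᵐ ξ ∂nuB, φ ξ < 1 := by
    have hBm : MeasurableSet {ξ | φ ξ = 1} := hφm (measurableSet_singleton 1)
    have hsub : shiftMap ⁻¹' {ξ | φ ξ = 1} ⊆ {ξ | φ ξ = 1} := by
      intro ξ hξ
      change φ (shiftMap ξ) = 1 at hξ
      change φ ξ = 1
      by_contra hne
      have := hmono (ξ 0) (hφ01 ξ) one_mem (lt_of_le_of_ne (hφ01 ξ).2 hne)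
      rw [← hinv, hξ] at this
      linarith [(hmaps (ξ 0) one_mem).2]
    rcases nuB_ergodic.ae_empty_or_univ_of_preimage_ae_le hBm.nullMeasurableSet
      (Eventually.of_forall hsub) with hh | hh
    · rw [ae_eq_empty] at hh
      have : ∀ᵐ ξ ∂nuB, ¬ (φ ξ = 1) := by
        rw [ae_iff]
        simpa using hh
      filter_upwards [this] with ξ hξ
      exact lt_of_le_of_ne (hφ01 ξ).2 hξ
    · exfalso
      have h1 : ∀ᵐ ξ ∂nuB, φ ξ = 1 := eventuallyEq_univ.1 hh
      have h2 : ∀ᵐ ξ ∂nuB, φ (shiftMap ξ) = 1 := nuB_mp.quasiMeasurePreserving.ae h1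
      have h3 : ∀ᵐ ξ ∂nuB, ¬ (ξ 0 = 2) := by
        filter_upwards [h1, h2] with ξ a b c
        rw [hinv, a, c] at b
        linarith
      rw [ae_iff] at h3
      have h4 := nuB_bernoulli.2 {0} (fun _ => 2)
      simp only [Finset.mem_singleton, forall_eq, Finset.prod_singleton] at h4
      simp only [not_not] at h3
      rw [h3] at h4
      have h5 := (ENNReal.ofReal_eq_zero.1 h4.symm)
      change (1:ℝ)/2 ≤ 0 at h5
      norm_num at h5
  have hlt : ∀ n, ∀ᵐ ξ ∂nuB, φ ξ < gtop h n ξ := by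
    intro n
    induction n with
    | zero => exact hlt1
    | succ k ih =>
      rw [← nuB_mp.map_eq, ae_map_iff measurable_shiftMap.aemeasurable
        (measurableSet_lt hφm (hgm _))]
      filter_upwards [ih] with ξ hξ
      rw [hinv, gtop_shift]
      exact hmono _ (hφ01 _) (hg01 _ _) hξ
  obtain ⟨M, hM⟩ : ∃ M, ∀ i, ∀ x ∈ Icc (0:ℝ) 1, deriv (h i) x ≤ M := by
    have : ∀ i, ∃ M, ∀ x ∈ Icc (0:ℝ) 1, deriv (h i) x ≤ M := by
      intro i
      obtain ⟨M, hM⟩ := (isCompact_Icc (a := (0:ℝ)) (b := 1)).bddAbove_image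
        ((hC1 i).continuous_deriv le_rfl).continuousOn
      exact ⟨M, fun x hx => hM (mem_image_of_mem _ hx)⟩
    choose M hM using this
    refine ⟨max (M 0) (max (M 1) (M 2)), fun i x hx => (hM i x hx).trans ?_⟩
    fin_cases i <;> simp
  let u : ℕ → Sig3 → ℝ := fun n ξ => Real.log (gtop h n ξ - φ ξ)
  have hum : ∀ n, Measurable (u n) := fun n =>
    Real.measurable_log.comp ((hgm n).sub hφm)
  let q : ℕ → Sig3 → ℝ := fun n ξ => u (n+1) (shiftMap ξ) - u n ξ
  have hqm : ∀ n, Measurable (q n) := fun n =>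
    ((hum (n+1)).comp measurable_shiftMap).sub (hum n)
  have hqe : ∀ n ξ, φ ξ < gtop h n ξ → q n ξ =
      Real.log ((h (ξ 0) (gtop h n ξ) - h (ξ 0) (φ ξ)) / (gtop h n ξ - φ ξ)) := by
    intro n ξ hξ
    have h1 := hmono (ξ 0) (hφ01 _) (hg01 _ _) hξ
    simp only [q, u]
    rw [gtop_shift, hinv, Real.log_div (by linarith) (by linarith)]
  set C := max (|Real.log lam|) (|Real.log M|) with hCdef
  have hlogb : ∀ y, lam ≤ y → y ≤ M → |Real.log y| ≤ C := by
    intro y h1 h2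
    rw [abs_le]
    have h3 := Real.log_le_log hlam h1
    have h4 := Real.log_le_log (hlam.trans_le h1) h2
    have h5 := neg_abs_le (Real.log lam)
    have h6 := le_abs_self (Real.log M)
    have h7 : |Real.log lam| ≤ C := le_max_left _ _
    have h8 : |Real.log M| ≤ C := le_max_right _ _
    constructor <;> linarith
  have hqb : ∀ n, ∀ᵐ ξ ∂nuB, |q n ξ| ≤ C := by
    intro n
    filter_upwards [hlt n] with ξ hξ
    rw [hqe n ξ hξ]
    obtain ⟨a, b⟩ := slope_bounds (h (ξ 0)) (hC1 _) lam M (hder _) (hM _) _ _ (hφ01 ξ).1 hξ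
      (hg01 n ξ).2
    exact hlogb _ a b
  have hqn : ∀ n, ∫ ξ, q n ξ ∂nuB ≤ 0 := by
    intro n
    refine integral_nonpos_of_cob (q n) (u n) (hqm n) (hum n) C (hqb n) ?_ ?_
    · filter_upwards [hlt n] with ξ hξ
      exact Real.log_nonpos (by linarith) (by linarith [(hφ01 ξ).1, (hg01 n ξ).2])
    · filter_upwards [nuB_mp.quasiMeasurePreserving.ae (hlt (n+1))] with ξ hξ
      simp only [q, u]
      have := Real.log_le_log (sub_pos.2 hξ) (sub_le_sub_right (hanti n (shiftMap ξ)) _)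
      linarith
  refine le_of_tendsto' (f := fun n => ∫ ξ, q n ξ ∂nuB) (x := atTop) ?_ hqn
  refine tendsto_integral_of_dominated_convergence (fun _ => C)
    (fun n => (hqm n).aestronglyMeasurable) (integrable_const _) hqb ?_
  filter_upwards [ae_all_iff.2 hlt] with ξ hξ
  have hd : HasDerivAt (h (ξ 0)) (deriv (h (ξ 0)) (φ ξ)) (φ ξ) :=
    ((hC1 (ξ 0)).differentiable (by norm_num)).differentiableAt.hasDerivAt
  have hpos : 0 < deriv (h (ξ 0)) (φ ξ) := hlam.trans_le (hder _ _ (hφ01 ξ))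
  have hs := (hasDerivAt_iff_tendsto_slope.1 hd).comp
    (tendsto_nhdsWithin_iff.2 ⟨hlim ξ, Eventually.of_forall fun n => (hξ n).ne'⟩)
  rw [abs_of_pos hpos]
  have hs2 := (Real.continuousAt_log hpos.ne').tendsto.comp hs
  refine hs2.congr fun n => ?_
  rw [hqe n ξ (hξ n)]
  simp [slope_def_field]

lemma measurable_phiC (fs : Fin 3 → ℝ → ℝ) : Measurable (phiC fs) := by
  have h1 : Measurable (fun q : Fin 3 × ℝ => deriv (fs q.1) q.2) :=
    measurable_from_prod_countable_right (fun i => measurable_deriv (fs i))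
  have h2 : Measurable (fun p : XSp => (p.1 0, (p.2 : ℝ))) :=
    (Measurable.comp (measurable_pi_apply (0:ℤ)) measurable_fst).prodMk
      (measurable_subtype_coe.comp measurable_snd)
  exact Real.measurable_log.comp (h1.comp h2).abs

lemma chiOf_lift (fs : Fin 3 → ℝ → ℝ) (φ : Sig3 → Set.Icc (0:ℝ) 1) (hφ : Measurable φ) :
    chiOf fs (nuB.map (fun ξ => (ξ, φ ξ))) =
      ∫ ξ, Real.log |deriv (fs (ξ 0)) (φ ξ : ℝ)| ∂nuB := by
  unfold chiOf
  rw [integral_map (Measurable.aemeasurable (by fun_prop))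
    (measurable_phiC fs).aestronglyMeasurable]
  rfl

/-- two ergodic lifts of the `(1/2,0,1/2)`-Bernoulli measure, one with
nonpositive and one with positive central exponent. -/
theorem stmt13 (f₀ f₁ f₂ : ℝ → ℝ) (β₀ lam₀ γ β₂ : ℝ)
    (h0 : F0cond f₀ β₀ lam₀) (h1 : F1cond f₁ γ lam₀) (h2 : F2cond f₂ β₂ lam₀) :
    ∃ μ₁ μ₂ : Measure XSp,
      IsProbabilityMeasure μ₁ ∧ IsProbabilityMeasure μ₂ ∧
      Ergodic (Gmap ![f₀, f₁, f₂]) μ₁ ∧ Ergodic (Gmap ![f₀, f₁, f₂]) μ₂ ∧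
      μ₁ (LamG ![f₀, f₁, f₂]) = 1 ∧ μ₂ (LamG ![f₀, f₁, f₂]) = 1 ∧
      IsBernoulli ![(1:ℝ)/2, 0, 1/2] (μ₁.map Prod.fst) ∧
      IsBernoulli ![(1:ℝ)/2, 0, 1/2] (μ₂.map Prod.fst) ∧
      chiOf ![f₀, f₁, f₂] μ₁ ≤ 0 ∧
      μ₂ Lam02 = 1 ∧
      chiOf ![f₀, f₁, f₂] μ₂ = (1/2) * Real.log (β₀ * β₂) ∧
      0 < chiOf ![f₀, f₁, f₂] μ₂ := by
  obtain ⟨c0, m0, s0, z0, o0, -, d0, b0, -, l0, -, e0⟩ := h0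
  obtain ⟨g1, -, -⟩ := h1
  obtain ⟨c2, m2, s2, z2, d2, b2, e2, p2, hp2, -, -, g2⟩ := h2
  have h21 : f₂ 1 < 1 := g2 1 ⟨hp2.2, le_rfl⟩
  have c1 : Continuous f₁ := by
    have : f₁ = fun x => γ * (1 - x) := funext g1
    rw [this]
    fun_prop
  have hfm : ∀ i, Measurable ((![f₀, f₁, f₂] : Fin 3 → ℝ → ℝ) i) := by
    intro i
    fin_cases i
    · exact c0.continuous.measurable
    · exact c1.measurable
    · exact c2.continuous.measurable
  obtain ⟨φ, hφm, hφi, hφl⟩ := top_graph ![f₀, f₀, f₂] lam₀ l0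
    (by intro i; fin_cases i; exacts [c0, c0, c2])
    (by intro i; fin_cases i; exacts [m0, m0, m2])
    (by intro i; fin_cases i; exacts [s0, s0, s2])
    (by intro i; fin_cases i; exacts [e0, e0, e2]) h21
  have hagree : ∀ j : Fin 3, j ≠ 1 →
      (![f₀, f₁, f₂] : Fin 3 → ℝ → ℝ) j = (![f₀, f₀, f₂] : Fin 3 → ℝ → ℝ) j := by
    intro j hj
    fin_cases j <;> simp at hj ⊢
  obtain ⟨P1, E1, L1, B1⟩ := lift_props ![f₀, f₁, f₂] hfm φ hφm (by
    intro ξ hξ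
    unfold Gmap
    refine Prod.ext rfl ?_
    simp only
    rw [hagree _ (hξ 0), ← hφi, projIcc_val])
  obtain ⟨P2, E2, L2, B2⟩ := lift_props ![f₀, f₁, f₂] hfm (fun _ => 0) measurable_const (by
    intro ξ hξ
    unfold Gmap
    refine Prod.ext rfl ?_
    simp only
    have : (![f₀, f₁, f₂] : Fin 3 → ℝ → ℝ) (ξ 0) ((0 : Icc (0:ℝ) 1) : ℝ)
        = ((0 : Icc (0:ℝ) 1) : ℝ) := by
      rw [hagree _ (hξ 0)]
      generalize ξ 0 = j
      fin_cases j <;> simp [z0, z2]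
    rw [this, projIcc_val])
  have X2 : chiOf ![f₀, f₁, f₂] (nuB.map (fun ξ => (ξ, (0 : Icc (0:ℝ) 1))))
      = (1/2) * Real.log (β₀ * β₂) := by
    rw [chiOf_lift _ (fun _ => 0) measurable_const]
    rw [integral_eval_zero (fun j => Real.log |deriv ((![f₀, f₁, f₂] : Fin 3 → ℝ → ℝ) j)
      ((0 : Icc (0:ℝ) 1) : ℝ)|)]
    simp [d0, d2]
    rw [Real.log_mul (by linarith) (by linarith)]
    ring
  refine ⟨_, _, P1, P2, E1, E2, L1, L2, B1, B2, ?_, ?_, X2, ?_⟩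
  · rw [chiOf_lift _ φ hφm]
    refine le_of_eq_of_le (integral_congr_ae ?_) hφl
    filter_upwards [nuB_ae_ne_one] with ξ hξ
    rw [hagree _ (hξ 0)]
  · apply le_antisymm prob_le_one
    refine le_trans ?_ (Measure.le_map_apply (Measurable.aemeasurable (by fun_prop)) _)
    have : ∀ᵐ ξ ∂nuB, ξ ∈ (fun ξ : Sig3 => (ξ, (0 : Icc (0:ℝ) 1))) ⁻¹' Lam02 := by
      filter_upwards [nuB_ae_ne_one] with ξ hξ
      exact ⟨hξ, rfl⟩
    exact ((measure_congr (eventuallyEq_univ.2 this)).trans measure_univ).ge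
  · rw [X2]
    have := Real.log_pos (one_lt_mul b0.le b2)
    linarith

end
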